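/- (Theorem 2.3, error bound with step-dependent coarse operators) Suppose M := sup_{n,k} ‖G_n^{(k)}‖ and D := sup_{n,k} ‖F − G_n^{(k)}‖ are finite (operator norms). Then for all k ≥ 0 and all n ≥ k+2, the error satisfies ‖e_n^{(k+1)}‖ ≤ D · (Σ_{j=0}^{n−k−2} M^j) · max_{0 ≤ m ≤ n−1} ‖e_m^{(k)}‖, where e_n^{(k)} := u_n^{(k)} − F^n u₀. -/

import Mathlib

/-- One step of the parareal correction, written for the error. -/
theorem parareal_error_succ {𝕜 E : Type*} [NontriviallyNormedField 𝕜] [NormedAddCommGroup E]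
    [NormedSpace 𝕜 E] {u₀ : E} {F : E →L[𝕜] E} {G : ℕ → ℕ → E →L[𝕜] E} {u : ℕ → ℕ → E}
    (hrec : ∀ n k, u (n + 1) (k + 1) =
      G (n + 1) (k + 1) (u n (k + 1)) + F (u n k) - G (n + 1) (k + 1) (u n k)) (n k : ℕ) :
    u (n + 1) (k + 1) - (F ^ (n + 1)) u₀ =
      G (n + 1) (k + 1) (u n (k + 1) - (F ^ n) u₀) +
        (F - G (n + 1) (k + 1)) (u n k - (F ^ n) u₀) := by
  rw [hrec, pow_succ']
  simp only [sub_apply, map_sub, mul_apply_eq_comp]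
  abel

/-- After `k` iterations the first `k` time steps are exact. -/
theorem parareal_error_eq_zero {𝕜 E : Type*} [NontriviallyNormedField 𝕜] [NormedAddCommGroup E]
    [NormedSpace 𝕜 E] {u₀ : E} {F : E →L[𝕜] E} {G : ℕ → ℕ → E →L[𝕜] E} {u : ℕ → ℕ → E}
    (h0 : ∀ k, u 0 k = u₀)
    (hrec : ∀ n k, u (n + 1) (k + 1) =
      G (n + 1) (k + 1) (u n (k + 1)) + F (u n k) - G (n + 1) (k + 1) (u n k))
    {n k : ℕ} (hnk : n ≤ k) : u n k - (F ^ n) u₀ = 0 := by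
  induction n generalizing k with
  | zero => simp [h0]
  | succ n ih =>
    obtain ⟨k, rfl⟩ : ∃ l, k = l + 1 := ⟨k - 1, by omega⟩
    rw [parareal_error_succ hrec, ih (by omega), ih (by omega), map_zero, map_zero, add_zero]

/-- The error at iteration `k + 1`, given any bound `B` on the preceding errors at iteration `k`. -/
theorem norm_parareal_error_le {𝕜 E : Type*} [NontriviallyNormedField 𝕜] [NormedAddCommGroup E]
    [NormedSpace 𝕜 E] {u₀ : E} {F : E →L[𝕜] E} {G : ℕ → ℕ → E →L[𝕜] E} {u : ℕ → ℕ → E}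
    (h0 : ∀ k, u 0 k = u₀)
    (hrec : ∀ n k, u (n + 1) (k + 1) =
      G (n + 1) (k + 1) (u n (k + 1)) + F (u n k) - G (n + 1) (k + 1) (u n k))
    {M D B : ℝ} (hM : ∀ n k, ‖G n k‖ ≤ M) (hD : ∀ n k, ‖F - G n k‖ ≤ D) (k p : ℕ)
    (hB : ∀ m < k + 1 + p, ‖u m k - (F ^ m) u₀‖ ≤ B) :
    ‖u (k + 1 + p) (k + 1) - (F ^ (k + 1 + p)) u₀‖ ≤ D * (∑ j ∈ Finset.range p, M ^ j) * B := by
  induction p with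
  | zero => rw [add_zero, parareal_error_eq_zero h0 hrec le_rfl]; simp
  | succ p ih =>
    have hM0 : 0 ≤ M := (norm_nonneg _).trans (hM 0 0)
    rw [← add_assoc, parareal_error_succ hrec, geom_sum_succ]
    calc _ ≤ M * (D * (∑ j ∈ Finset.range p, M ^ j) * B) + D * B :=
          norm_add_le_of_le
            (ContinuousLinearMap.le_of_opNorm_le_of_le _ (hM _ _)
              (ih fun m hm => hB m (by omega)))
            (ContinuousLinearMap.le_of_opNorm_le_of_le _ (hD _ _) (hB _ (by omega)))
      _ = _ := by ring

/-- **Theorem 2.3 (error bound with step-dependent coarse operators).**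
If `M` bounds all operator norms `‖G n k‖` and `D` bounds all `‖F - G n k‖`, then for
all `k ≥ 0` and all `n ≥ k+2`, the error `e n k := u n k - F^n u₀` satisfies
`‖e n (k+1)‖ ≤ D ⬝ (∑_{j=0}^{n-k-2} M^j) ⬝ max_{0 ≤ m ≤ n-1} ‖e m k‖`. -/
theorem theta_parareal_error_bound_variable_coarse
    {E : Type*} [NormedAddCommGroup E] [NormedSpace ℝ E] [FiniteDimensional ℝ E]
    (u₀ : E) (F : E →L[ℝ] E) (G : ℕ → ℕ → E →L[ℝ] E)
    (u : ℕ → ℕ → E)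
    (h0 : ∀ k, u 0 k = u₀)
    (hinit : ∀ n, u (n + 1) 0 = G (n + 1) 0 (u n 0))
    (hrec : ∀ n k, u (n + 1) (k + 1) =
      G (n + 1) (k + 1) (u n (k + 1)) + F (u n k) - G (n + 1) (k + 1) (u n k))
    (M D : ℝ)
    (hM : ∀ n k, ‖G n k‖ ≤ M) (hD : ∀ n k, ‖F - G n k‖ ≤ D) :
    ∀ k n, ∀ hn : k + 2 ≤ n,
      ‖u n (k + 1) - (F ^ n) u₀‖ ≤
        D * (∑ j ∈ Finset.range (n - k - 1), M ^ j) *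
          ((Finset.range n).sup' (Finset.nonempty_range_iff.mpr (by omega))
            fun m => ‖u m k - (F ^ m) u₀‖) := by
  intro k n hn
  obtain ⟨p, rfl⟩ : ∃ p, n = k + 1 + p := ⟨n - k - 1, by omega⟩
  rw [show k + 1 + p - k - 1 = p by omega]
  exact norm_parareal_error_le h0 hrec hM hD k p fun m hm =>
    Finset.le_sup' (fun m => ‖u m k - (F ^ m) u₀‖) (Finset.mem_range.mpr hm)
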